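/- Let Δ and Γ be Cohen-Macaulay simplicial complexes of the same dimension d on the vertex set [n], and assume dim(Δ ∩ Γ) = d − 1. Then Δ ∪ Γ is Cohen-Macaulay if and only if Δ ∩ Γ is Cohen-Macaulay. -/

import Mathlib

open MvPolynomial CategoryTheory CategoryTheory.Limits

noncomputable section

/-- A simplicial complex on a vertex set `V`: a collection of finite subsets of `V`
closed under taking subsets. -/
def IsSimplicialComplex {V : Type} (Δ : Set (Finset V)) : Prop :=
  ∀ F ∈ Δ, ∀ G : Finset V, G ⊆ F → G ∈ Δ

/-- The dimension of a simplicial complex: `max {|F| - 1 : F ∈ Δ}`. -/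
def complexDim {V : Type} (Δ : Set (Finset V)) : ℤ :=
  sSup ((fun F : Finset V => (F.card : ℤ) - 1) '' Δ)

/-- The star of a face: `st_Δ(F) = {H ∈ Δ : H ∪ F ∈ Δ}`. -/
def complexStar {V : Type} [DecidableEq V] (Δ : Set (Finset V)) (F : Finset V) :
    Set (Finset V) :=
  {H | H ∈ Δ ∧ H ∪ F ∈ Δ}

/-- The facets (maximal faces) of a simplicial complex. -/
def facets {V : Type} (Δ : Set (Finset V)) : Set (Finset V) :=
  {F | F ∈ Δ ∧ ∀ G ∈ Δ, F ⊆ G → F = G}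

/-- The Stanley–Reisner ideal of a simplicial complex `Δ`:
generated by the squarefree monomials `∏_{i ∈ F} x_i` with `F ∉ Δ`. -/
def srIdeal (k : Type) [Field k] {V : Type} (Δ : Set (Finset V)) :
    Ideal (MvPolynomial V k) :=
  Ideal.span {m | ∃ F : Finset V, F ∉ Δ ∧ m = ∏ i ∈ F, X i}

/-- The face prime `P_F = (x_j : j ∉ F)`. -/
def facePrime (k : Type) [Field k] {V : Type} (F : Finset V) :
    Ideal (MvPolynomial V k) :=
  Ideal.span ((X : V → MvPolynomial V k) '' {j | j ∉ F})

/-- The `m`-th symbolic power of the Stanley–Reisner ideal: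
`I_Δ^{(m)} = ⋂_{F facet of Δ} P_F^m`. -/
def symbolicPower (k : Type) [Field k] {V : Type} (Δ : Set (Finset V)) (m : ℕ) :
    Ideal (MvPolynomial V k) :=
  ⨅ F ∈ facets Δ, (facePrime k F) ^ m

/-- The homogeneous maximal ideal `m = (x_1, …, x_n)` of the polynomial ring. -/
def maxIdeal (k : Type) [Field k] (V : Type) : Ideal (MvPolynomial V k) :=
  Ideal.span (Set.range (X : V → MvPolynomial V k))

/-- The `i`-th local cohomology module `H^i_m(S/I)`. -/
def locCoh (k : Type) [Field k] (V : Type) (I : Ideal (MvPolynomial V k)) (i : ℕ) :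
    ModuleCat (MvPolynomial V k) :=
  (localCohomology (maxIdeal k V) i).obj
    (ModuleCat.of (MvPolynomial V k) (MvPolynomial V k ⧸ I))

/-- `S/I` is Cohen–Macaulay: `H^i_m(S/I) = 0` for all `i < dim S/I`. -/
def quotCM (k : Type) [Field k] (V : Type) (I : Ideal (MvPolynomial V k)) : Prop :=
  ∀ i : ℕ, (i : WithBot (WithTop ℕ)) < ringKrullDim (MvPolynomial V k ⧸ I) →
    Subsingleton (locCoh k V I i)

/-- `S/I` is generalized Cohen–Macaulay: `H^i_m(S/I)` has finite length for all
`i < dim S/I`. -/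
def quotGCM (k : Type) [Field k] (V : Type) (I : Ideal (MvPolynomial V k)) : Prop :=
  ∀ i : ℕ, (i : WithBot (WithTop ℕ)) < ringKrullDim (MvPolynomial V k ⧸ I) →
    IsFiniteLength (MvPolynomial V k) (locCoh k V I i)

/-- `S/I` is `r`-Buchsbaum: `m^r · H^i_m(S/I) = 0` for all `i < dim S/I`. -/
def quotKBuchsbaum (k : Type) [Field k] (V : Type) (I : Ideal (MvPolynomial V k))
    (r : ℕ) : Prop :=
  ∀ i : ℕ, (i : WithBot (WithTop ℕ)) < ringKrullDim (MvPolynomial V k ⧸ I) →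
    ∀ x ∈ (maxIdeal k V) ^ r, ∀ y : locCoh k V I i, x • y = 0

/-- The canonical map `Ext^i_S(S/m, S/I) → H^i_m(S/I)`, realized as the colimit
injection at the first power of `m` in the direct system defining local cohomology. -/
def canonicalExtToLocCoh (k : Type) [Field k] (V : Type) (I : Ideal (MvPolynomial V k))
    (i : ℕ) :
    ((localCohomology.diagram (localCohomology.idealPowersDiagram (maxIdeal k V)) i).obj
        (Opposite.op (Opposite.op (1 : ℕ)))).obj
      (ModuleCat.of (MvPolynomial V k) (MvPolynomial V k ⧸ I)) ⟶ locCoh k V I i :=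
  letI := localCohomology.hasColimitDiagram.{0,0}
    (localCohomology.idealPowersDiagram (maxIdeal k V)) i
  (colimit.ι (localCohomology.diagram (localCohomology.idealPowersDiagram (maxIdeal k V)) i)
    (Opposite.op (Opposite.op (1 : ℕ)))).app (ModuleCat.of (MvPolynomial V k) (MvPolynomial V k ⧸ I))

/-- `S/I` is Buchsbaum: the canonical map `Ext^i_S(S/m, S/I) → H^i_m(S/I)` is
surjective for all `i < dim S/I`. -/
def quotBuchsbaum (k : Type) [Field k] (V : Type) (I : Ideal (MvPolynomial V k)) : Prop :=
  ∀ i : ℕ, (i : WithBot (WithTop ℕ)) < ringKrullDim (MvPolynomial V k ⧸ I) →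
    Function.Surjective (canonicalExtToLocCoh k V I i)

/-- A simplicial complex is Cohen–Macaulay if its Stanley–Reisner ring is
Cohen–Macaulay over every field. -/
def complexCM {V : Type} (Δ : Set (Finset V)) : Prop :=
  ∀ (k : Type) [Field k], quotCM k V (srIdeal k Δ)

/-- A simplicial complex is Buchsbaum if its Stanley–Reisner ring is Buchsbaum over
every field. -/
def complexBuchsbaum {V : Type} (Δ : Set (Finset V)) : Prop :=
  ∀ (k : Type) [Field k], quotBuchsbaum k V (srIdeal k Δ)

/-- The independence complex of a graph: faces are the independent sets. -/
def indepComplex {V : Type} (G : SimpleGraph V) : Set (Finset V) :=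
  {F | ∀ i ∈ F, ∀ j ∈ F, ¬ G.Adj i j}

/-- The edge ideal `I(G) = (x_i x_j : ij ∈ E(G))`. -/
def edgeIdeal (k : Type) [Field k] {V : Type} (G : SimpleGraph V) :
    Ideal (MvPolynomial V k) :=
  Ideal.span {m | ∃ i j : V, G.Adj i j ∧ m = X i * X j}

/-- The independence number `α(G)`. -/
def indepNumber {V : Type} (G : SimpleGraph V) : ℕ :=
  sSup {c | ∃ F ∈ indepComplex G, F.card = c}

/-- A graph is Cohen–Macaulay if its independence complex is. -/
def graphCM {V : Type} (G : SimpleGraph V) : Prop :=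
  complexCM (indepComplex G)

/-- The vertex set of the localization `G_{pq} = G \ (N(p) ∪ N(q))` of `G` at an
edge `pq`. -/
def edgeLocSet {V : Type} (G : SimpleGraph V) (p q : V) : Set V :=
  {v | v ∉ G.neighborSet p ∪ G.neighborSet q}

/-- The localization of `G` at an edge `pq`: the induced subgraph on the vertices not
adjacent to `p` or `q` (this removes `p` and `q` as well). -/
def edgeLoc {V : Type} (G : SimpleGraph V) (p q : V) :
    SimpleGraph (edgeLocSet G p q) :=
  G.induce (edgeLocSet G p q)

/-- `G` is special Cohen–Macaulay: `G` is Cohen–Macaulay and for every edge `pq`,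
`G_{pq}` is Cohen–Macaulay with `α(G_{pq}) = α(G) - 1`. -/
def specialCM {V : Type} (G : SimpleGraph V) : Prop :=
  graphCM G ∧ ∀ p q : V, G.Adj p q →
    graphCM (edgeLoc G p q) ∧ indepNumber (edgeLoc G p q) + 1 = indepNumber G

/-- The vertex set of `G_i = G \ ({i} ∪ N(i))`. -/
def vertexLocSet {V : Type} (G : SimpleGraph V) (i : V) : Set V :=
  {v | v ≠ i ∧ v ∉ G.neighborSet i}

/-- `G_i = G \ ({i} ∪ N(i))`: the induced subgraph obtained by deleting `i` and all
its neighbors. -/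
def vertexLoc {V : Type} (G : SimpleGraph V) (i : V) :
    SimpleGraph (vertexLocSet G i) :=
  G.induce (vertexLocSet G i)

/-- A graph is unmixed if all its maximal independent sets have the same cardinality. -/
def graphUnmixed {V : Type} (G : SimpleGraph V) : Prop :=
  ∀ F ∈ facets (indepComplex G), ∀ F' ∈ facets (indepComplex G), F.card = F'.card

/-- `G` has no isolated vertices. -/
def noIsolated {V : Type} (G : SimpleGraph V) : Prop :=
  ∀ v : V, ∃ w : V, G.Adj v w

end

section
open Opposite

section opHomology
variable {R : Type*} [Ring R] {ι : Type*} {c : ComplexShape ι}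

/-- The element `x` of (the opposite of) the homology of a complex `K` in the opposite category of
modules is the class of the cocycle `f`. -/
def RepresentsClass (K : HomologicalComplex (ModuleCat R)ᵒᵖ c) (i : ι)
    (f : (K.X i).unop) (x : (K.homology i).unop) : Prop :=
  ∃ z : (K.opcycles i).unop, (K.pOpcycles i).unop z = f ∧ (K.homologyι i).unop z = x

variable {K L : HomologicalComplex (ModuleCat R)ᵒᵖ c} {i : ι}

lemma exists_representsClass (x : (K.homology i).unop) :
    ∃ f, RepresentsClass K i f x ∧ ∀ j, (K.d j i).unop f = 0 := by
  obtain ⟨z, hz⟩ := (ModuleCat.epi_iff_surjective (K.homologyι i).unop).1 inferInstance x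
  refine ⟨_, ⟨z, rfl, hz⟩, fun j => ?_⟩
  rw [← ModuleCat.comp_apply, ← unop_comp, K.d_pOpcycles]
  rfl

lemma RepresentsClass.of_cocycle {f : (K.X i).unop} (h : ∀ j, (K.d j i).unop f = 0) :
    ∃ x, RepresentsClass K i f x := by
  have e : (ShortComplex.mk _ _ (K.d_pOpcycles (c.prev i) i)).Exact :=
    ShortComplex.exact_of_g_is_cokernel _ (K.opcyclesIsCokernel _ i rfl)
  obtain ⟨z, hz⟩ := (ShortComplex.moduleCat_exact_iff _).1 e.unop f (h _)
  exact ⟨_, z, hz, rfl⟩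

lemma RepresentsClass.eq_zero_iff {f : (K.X i).unop} {x : (K.homology i).unop}
    (h : RepresentsClass K i f x) :
    x = 0 ↔ ∃ j, ∃ g : (K.X j).unop, (K.d i j).unop g = f := by
  obtain ⟨z, rfl, rfl⟩ := h
  have inj : Function.Injective (K.pOpcycles i).unop :=
    (ModuleCat.mono_iff_injective _).1 inferInstance
  constructor
  · intro hz
    have e : (ShortComplex.mk _ _ (K.homologyι_comp_fromOpcycles i (c.next i))).Exact :=
      ShortComplex.exact_of_f_is_kernel _ (K.homologyIsKernel i _ rfl)
    obtain ⟨g, hg⟩ := (ShortComplex.moduleCat_exact_iff _).1 e.unop z hz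
    refine ⟨_, g, ?_⟩
    exact (congrArg (fun t => ModuleCat.Hom.hom (Quiver.Hom.unop t) g)
      (K.p_fromOpcycles i (c.next i)).symm).trans (congrArg (K.pOpcycles i).unop hg)
  · rintro ⟨j, g, hg⟩
    have : z = (K.fromOpcycles i j).unop g := by
      apply inj
      rw [← hg, ← ModuleCat.comp_apply, ← unop_comp, K.p_fromOpcycles]
    rw [this, ← ModuleCat.comp_apply, ← unop_comp, K.homologyι_comp_fromOpcycles]
    rfl

lemma RepresentsClass.map (φ : K ⟶ L) {f : (L.X i).unop} {x : (L.homology i).unop}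
    (h : RepresentsClass L i f x) :
    RepresentsClass K i ((φ.f i).unop f) ((HomologicalComplex.homologyMap φ i).unop x) := by
  obtain ⟨z, rfl, rfl⟩ := h
  refine ⟨(HomologicalComplex.opcyclesMap φ i).unop z, ?_, ?_⟩
  · simp only [← ModuleCat.comp_apply, ← unop_comp, HomologicalComplex.p_opcyclesMap]
  · simp only [← ModuleCat.comp_apply, ← unop_comp, HomologicalComplex.homologyι_naturality]
end opHomology

section ext
variable {C : Type*} [Category* C] [Abelian C]

/-- A cochain `f` of `Hom(P, N)` is a coboundary if it factors through a differential of `P`. -/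
def IsCoboundary (P : ChainComplex C ℕ) (N : C) (i : ℕ) (f : P.X i ⟶ N) : Prop :=
  ∃ j, ∃ g : P.X j ⟶ N, P.d i j ≫ g = f

lemma IsCoboundary.exists_pred {P : ChainComplex C ℕ} {N : C} {i : ℕ} {f : P.X i ⟶ N}
    (h : IsCoboundary P N i f) : ∃ g : P.X (i - 1) ⟶ N, P.d i (i - 1) ≫ g = f := by
  obtain ⟨j, g, rfl⟩ := h
  by_cases hj : j + 1 = i
  · subst hj
    exact ⟨g, rfl⟩
  · exact ⟨0, by rw [P.shape _ _ hj]; simp⟩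

lemma isCocycle_of_succ {P : ChainComplex C ℕ} {N : C} {i : ℕ} {f : P.X i ⟶ N}
    (h : P.d (i + 1) i ≫ f = 0) (j : ℕ) : P.d j i ≫ f = 0 := by
  by_cases hj : i + 1 = j
  · exact hj ▸ h
  · rw [P.shape _ _ hj, zero_comp]

variable {R : Type*} [Ring R] [Linear R C] [EnoughProjectives C]

/-- The element `x` of `Ext^i(X, N)` is the class of the cochain `f` of `Hom(P, N)`, where `P` is a
projective resolution of `X`. -/
noncomputable def ExtClass {X : C} (P : ProjectiveResolution X) (N : C) (i : ℕ)
    (f : P.complex.X i ⟶ N) (x : ((Ext R C i).obj (op X)).obj N) : Prop :=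
  RepresentsClass ((((linearYoneda R C).obj N).rightOp.mapHomologicalComplex _).obj P.complex) i f
    ((P.isoLeftDerivedObj ((linearYoneda R C).obj N).rightOp i).inv.unop x)

lemma ExtClass.exists_cocycle {X : C} (P : ProjectiveResolution X) (N : C) (i : ℕ)
    (x : ((Ext R C i).obj (op X)).obj N) :
    ∃ f, ExtClass P N i f x ∧ ∀ j, P.complex.d j i ≫ f = 0 :=
  exists_representsClass
    (K := (((linearYoneda R C).obj N).rightOp.mapHomologicalComplex _).obj P.complex)
    ((P.isoLeftDerivedObj ((linearYoneda R C).obj N).rightOp i).inv.unop x)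

lemma ExtClass.of_cocycle {X : C} (P : ProjectiveResolution X) (N : C) (i : ℕ)
    (f : P.complex.X i ⟶ N) (hf : ∀ j, P.complex.d j i ≫ f = 0) :
    ∃ x : ((Ext R C i).obj (op X)).obj N, ExtClass P N i f x := by
  obtain ⟨x, hx⟩ := RepresentsClass.of_cocycle (R := R) (i := i) (f := f) (K :=
    (((linearYoneda R C).obj N).rightOp.mapHomologicalComplex _).obj P.complex) hf
  refine ⟨(P.isoLeftDerivedObj ((linearYoneda R C).obj N).rightOp i).hom.unop x, ?_⟩
  have e : (P.isoLeftDerivedObj ((linearYoneda R C).obj N).rightOp i).inv.unop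
      ((P.isoLeftDerivedObj ((linearYoneda R C).obj N).rightOp i).hom.unop x) = x :=
    congrArg (fun t => ModuleCat.Hom.hom (Quiver.Hom.unop t) x)
      (P.isoLeftDerivedObj ((linearYoneda R C).obj N).rightOp i).inv_hom_id
  exact (congrArg (RepresentsClass _ i _) e).mpr hx

lemma ExtClass.eq_zero_iff {X : C} {P : ProjectiveResolution X} {N : C} {i : ℕ}
    {f : P.complex.X i ⟶ N}
    {x : ((Ext R C i).obj (op X)).obj N} (h : ExtClass P N i f x) :
    x = 0 ↔ IsCoboundary P.complex N i f := by
  refine Iff.trans ?_ (RepresentsClass.eq_zero_iff h)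
  exact ((injective_iff_map_eq_zero' (ModuleCat.Hom.hom
    (P.isoLeftDerivedObj ((linearYoneda R C).obj N).rightOp i).inv.unop)).1
      ((ModuleCat.mono_iff_injective _).1 inferInstance) x).symm

lemma ExtClass.map {X Y : C} {P : ProjectiveResolution X} {Q : ProjectiveResolution Y}
    (u : X ⟶ Y) (φ : P.complex ⟶ Q.complex) (comm : φ.f 0 ≫ Q.π.f 0 = P.π.f 0 ≫ u)
    {N : C} {i : ℕ}
    {f : Q.complex.X i ⟶ N} {x : ((Ext R C i).obj (op Y)).obj N} (h : ExtClass Q N i f x) :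
    ExtClass P N i (φ.f i ≫ f) (((Ext R C i).map u.op).app N x) := by
  have e : (P.isoLeftDerivedObj ((linearYoneda R C).obj N).rightOp i).inv.unop
      (((Ext R C i).map u.op).app N x) = (HomologicalComplex.homologyMap
        ((((linearYoneda R C).obj N).rightOp.mapHomologicalComplex _).map φ) i).unop
      ((Q.isoLeftDerivedObj ((linearYoneda R C).obj N).rightOp i).inv.unop x) :=
    congrArg (fun t => ModuleCat.Hom.hom (Quiver.Hom.unop t) x)
      (ProjectiveResolution.isoLeftDerivedObj_inv_naturality u P Q φ comm
        ((linearYoneda R C).obj N).rightOp i)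
  have := RepresentsClass.map
    ((((linearYoneda R C).obj N).rightOp.mapHomologicalComplex _).map φ) h
  exact (congrArg (RepresentsClass _ i _) e).mpr this
end ext

section localCohomology
variable {R : Type} [CommRing R] (J : Ideal R)

/-- The module `R ⧸ J ^ t`. -/
noncomputable abbrev quotPow (t : ℕ) : ModuleCat R := ModuleCat.of R (R ⧸ J ^ t)

/-- The projection `R ⧸ J ^ t ⟶ R ⧸ J ^ s` for `s ≤ t`. -/
noncomputable abbrev quotPowMap {s t : ℕ} (h : s ≤ t) : quotPow J t ⟶ quotPow J s :=
  ModuleCat.ofHom (Submodule.mapQ _ _ LinearMap.id (Ideal.pow_le_pow_right h))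

/-- A chosen projective resolution of `R ⧸ J ^ t`. -/
noncomputable abbrev quotPowRes (t : ℕ) : ProjectiveResolution (quotPow J t) :=
  projectiveResolution (quotPow J t)

/-- A chain map between resolutions lifting the projection `R ⧸ J ^ t ⟶ R ⧸ J ^ s`. -/
def IsTransition {s t : ℕ} (φ : (quotPowRes J t).complex ⟶ (quotPowRes J s).complex) : Prop :=
  ∃ h : s ≤ t, φ.f 0 ≫ (quotPowRes J s).π.f 0 = (quotPowRes J t).π.f 0 ≫ quotPowMap J h

variable {J} in
lemma IsTransition.comp {s t u : ℕ} {φ : (quotPowRes J t).complex ⟶ (quotPowRes J s).complex}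
    {ψ : (quotPowRes J u).complex ⟶ (quotPowRes J t).complex}
    (hψ : IsTransition J ψ) (hφ : IsTransition J φ) : IsTransition J (ψ ≫ φ) := by
  obtain ⟨h, e⟩ := hφ
  obtain ⟨h', e'⟩ := hψ
  refine ⟨h.trans h', ?_⟩
  have : quotPowMap J (h.trans h') = quotPowMap J h' ≫ quotPowMap J h := by
    refine ModuleCat.hom_ext (LinearMap.ext fun x => ?_)
    obtain ⟨x, rfl⟩ := Submodule.Quotient.mk_surjective _ x
    rfl
  rw [HomologicalComplex.comp_f, Category.assoc, e, this]
  exact (Category.assoc _ _ _).symm.trans ((congrArg (· ≫ quotPowMap J h) e').trans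
    (Category.assoc _ _ _))

lemma exists_isTransition {s t : ℕ} (h : s ≤ t) :
    ∃ φ : (quotPowRes J t).complex ⟶ (quotPowRes J s).complex, IsTransition J φ :=
  ⟨ProjectiveResolution.lift (quotPowMap J h) _ _, h,
    ProjectiveResolution.lift_commutes_zero _ _ _⟩

lemma subsingleton_localCohomology_iff_ext (N : ModuleCat R) (i : ℕ) :
    Subsingleton ((localCohomology J i).obj N) ↔
      ∀ (s : ℕ) (x : ((Ext R (ModuleCat R) i).obj (op (quotPow J s))).obj N),
        ∃ (t : ℕ) (h : s ≤ t), ((Ext R (ModuleCat R) i).map (quotPowMap J h).op).app N x = 0 := by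
  let F := localCohomology.diagram (localCohomology.idealPowersDiagram J) i
  have := localCohomology.hasColimitDiagram.{0, 0} (localCohomology.idealPowersDiagram J) i
  let c := ((evaluation _ _).obj N).mapCocone (colimit.cocone F)
  let hc : IsColimit c := isColimitOfPreserves _ (colimit.isColimit F)
  change Subsingleton c.pt ↔ _
  constructor
  · intro hs s x
    obtain ⟨k, f, g, e⟩ := Concrete.isColimit_exists_of_rep_eq _ hc (i := op (op s)) (j := op (op s))
       x 0 (Subsingleton.elim (α := c.pt) _ _)
    refine ⟨unop (unop k), leOfHom f.unop.unop, Eq.trans ?_ (e.trans (map_zero _))⟩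
    rfl
  · intro H
    refine subsingleton_of_forall_eq 0 fun y => ?_
    obtain ⟨j, x, rfl⟩ := Concrete.isColimit_exists_rep _ hc y
    obtain ⟨t, h, e⟩ := H (unop (unop j)) x
    have := c.w (homOfLE h).op.op
    rw [← this]
    exact (congrArg (c.ι.app (op (op t))) e).trans (map_zero _)

/-- A cochain which becomes a coboundary after restriction to the resolution of some
`R ⧸ J ^ t`; for cocycles this says that the class in local cohomology vanishes. -/
def IsLocallyCoboundary (N : ModuleCat R) (i : ℕ) {s : ℕ}
    (f : (quotPowRes J s).complex.X i ⟶ N) : Prop :=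
  ∃ (t : ℕ) (φ : (quotPowRes J t).complex ⟶ (quotPowRes J s).complex),
    IsTransition J φ ∧ IsCoboundary (quotPowRes J t).complex N i (φ.f i ≫ f)

lemma subsingleton_localCohomology_iff (N : ModuleCat R) (i : ℕ) :
    Subsingleton ((localCohomology J i).obj N) ↔
      ∀ (s : ℕ) (f : (quotPowRes J s).complex.X i ⟶ N),
        (∀ j, (quotPowRes J s).complex.d j i ≫ f = 0) → IsLocallyCoboundary J N i f := by
  rw [subsingleton_localCohomology_iff_ext]
  constructor
  · intro H s f hf
    obtain ⟨x, hx⟩ := ExtClass.of_cocycle (R := R) (quotPowRes J s) N i f hf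
    obtain ⟨t, h, e⟩ := H s x
    obtain ⟨φ, hφ⟩ := exists_isTransition J h
    exact ⟨t, φ, hφ, ((hx.map (quotPowMap J h) φ hφ.2).eq_zero_iff).1 e⟩
  · intro H s x
    obtain ⟨f, hx, hf⟩ := ExtClass.exists_cocycle (quotPowRes J s) N i x
    obtain ⟨t, φ, ⟨h, hφ⟩, e⟩ := H s f hf
    exact ⟨t, h, ((hx.map (quotPowMap J h) φ hφ).eq_zero_iff).2 e⟩

variable {J} {S : ShortComplex (ModuleCat R)} (hS : S.ShortExact) {i : ℕ}
include hS

lemma subsingleton_localCohomology_zero_X₁ (h₂ : Subsingleton ((localCohomology J 0).obj S.X₂)) :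
    Subsingleton ((localCohomology J 0).obj S.X₁) := by
  have := hS.mono_f
  rw [subsingleton_localCohomology_iff] at h₂ ⊢
  intro s f hf
  obtain ⟨t, φ, hφ, h⟩ := h₂ s (f ≫ S.f) fun j => by rw [reassoc_of% hf j, zero_comp]
  obtain ⟨g, hg⟩ := h.exists_pred
  refine ⟨t, φ, hφ, 0, 0, ?_⟩
  rw [← cancel_mono S.f, Category.assoc, Category.assoc, ← hg,
    (quotPowRes J t).complex.shape _ _ (by simp)]
  simp

lemma subsingleton_localCohomology_succ_X₁
    (h₃ : Subsingleton ((localCohomology J i).obj S.X₃))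
    (h₂ : Subsingleton ((localCohomology J (i + 1)).obj S.X₂)) :
    Subsingleton ((localCohomology J (i + 1)).obj S.X₁) := by
  have := hS.mono_f
  have := hS.epi_g
  rw [subsingleton_localCohomology_iff] at h₂ h₃ ⊢
  intro s f hf
  obtain ⟨t, φ, hφ, h⟩ := h₂ s (f ≫ S.f) fun j => by rw [reassoc_of% hf j, zero_comp]
  obtain ⟨g, hg : (quotPowRes J t).complex.d (i + 1) i ≫ g = _⟩ := h.exists_pred
  obtain ⟨u, ψ, hψ, l, k, hk⟩ := h₃ t (g ≫ S.g) <| isCocycle_of_succ <| by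
    rw [reassoc_of% hg, S.zero]
    simp
  let k' := Projective.factorThru k S.g
  have hk' : k' ≫ S.g = k := Projective.factorThru_comp _ _
  let e := hS.exact.lift (ψ.f i ≫ g - (quotPowRes J u).complex.d i l ≫ k') (by
    rw [Preadditive.sub_comp, Category.assoc, Category.assoc, hk', hk, sub_self])
  have he : e ≫ S.f = ψ.f i ≫ g - (quotPowRes J u).complex.d i l ≫ k' := hS.exact.lift_f _ _
  refine ⟨u, ψ ≫ φ, hψ.comp hφ, i, e, ?_⟩
  rw [← cancel_mono S.f, Category.assoc, he, Preadditive.comp_sub]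
  simp [← hg]

lemma subsingleton_localCohomology_X₃
    (h₂ : Subsingleton ((localCohomology J i).obj S.X₂))
    (h₁ : Subsingleton ((localCohomology J (i + 1)).obj S.X₁)) :
    Subsingleton ((localCohomology J i).obj S.X₃) := by
  have := hS.mono_f
  have := hS.epi_g
  rw [subsingleton_localCohomology_iff] at h₁ h₂ ⊢
  intro s f hf
  let f' := Projective.factorThru f S.g
  have hf' : f' ≫ S.g = f := Projective.factorThru_comp _ _
  let e := hS.exact.lift ((quotPowRes J s).complex.d (i + 1) i ≫ f') (by
    rw [Category.assoc, hf', hf])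
  have he : e ≫ S.f = (quotPowRes J s).complex.d (i + 1) i ≫ f' := hS.exact.lift_f _ _
  obtain ⟨t, φ, hφ, h⟩ := h₁ s e fun j => by
    rw [← cancel_mono S.f, Category.assoc, he]
    simp
  obtain ⟨k, hk⟩ : ∃ k : (quotPowRes J t).complex.X i ⟶ S.X₁,
      (quotPowRes J t).complex.d (i + 1) i ≫ k = φ.f (i + 1) ≫ e := h.exists_pred
  obtain ⟨u, ψ, hψ, l, m, hm⟩ := h₂ t (φ.f i ≫ f' - k ≫ S.f) <| isCocycle_of_succ <| by
    rw [Preadditive.comp_sub, reassoc_of% hk, he]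
    simp
  refine ⟨u, ψ ≫ φ, hψ.comp hφ, l, m ≫ S.g, ?_⟩
  rw [reassoc_of% hm]
  simp [hf']

lemma subsingleton_localCohomology_X₂
    (h₁ : Subsingleton ((localCohomology J i).obj S.X₁))
    (h₃ : Subsingleton ((localCohomology J i).obj S.X₃)) :
    Subsingleton ((localCohomology J i).obj S.X₂) := by
  have := hS.mono_f
  have := hS.epi_g
  rw [subsingleton_localCohomology_iff] at h₁ h₃ ⊢
  intro s f hf
  obtain ⟨t, φ, hφ, h⟩ := h₃ s (f ≫ S.g) fun j => by rw [reassoc_of% hf j, zero_comp]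
  obtain ⟨g, hg⟩ := h.exists_pred
  let g' := Projective.factorThru g S.g
  have hg' : g' ≫ S.g = g := Projective.factorThru_comp _ _
  let e := hS.exact.lift (φ.f i ≫ f - (quotPowRes J t).complex.d i (i - 1) ≫ g') (by
    rw [Preadditive.sub_comp, Category.assoc, Category.assoc, hg', hg, sub_self])
  have he : e ≫ S.f = φ.f i ≫ f - (quotPowRes J t).complex.d i (i - 1) ≫ g' :=
    hS.exact.lift_f _ _
  obtain ⟨u, ψ, hψ, h'⟩ := h₁ t e fun l => by
    rw [← cancel_mono S.f, Category.assoc, he, Preadditive.comp_sub, ← φ.comm_assoc, hf l]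
    simp
  obtain ⟨m, hm⟩ := h'.exists_pred
  refine ⟨u, ψ ≫ φ, hψ.comp hφ, i - 1, m ≫ S.f + ψ.f (i - 1) ≫ g', ?_⟩
  rw [Preadditive.comp_add, reassoc_of% hm, he]
  simp
end localCohomology

section quotients
variable {R : Type} [CommRing R] (I J : Ideal R)

/-- The sequence `R ⧸ I ⊓ J ⟶ R ⧸ I × R ⧸ J ⟶ R ⧸ I ⊔ J`. -/
noncomputable def mayerVietoris : ShortComplex (ModuleCat R) :=
  ShortComplex.mk
    (X₁ := ModuleCat.of R (R ⧸ I ⊓ J)) (X₂ := ModuleCat.of R ((R ⧸ I) × (R ⧸ J)))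
    (X₃ := ModuleCat.of R (R ⧸ I ⊔ J))
    (ModuleCat.ofHom ((Submodule.factor inf_le_left).prod (Submodule.factor inf_le_right)))
    (ModuleCat.ofHom ((Submodule.factor le_sup_left).coprod (-Submodule.factor le_sup_right)))
    (by
      refine ModuleCat.hom_ext (LinearMap.ext fun x => ?_)
      obtain ⟨x, rfl⟩ := Submodule.Quotient.mk_surjective _ x
      simp)

lemma mayerVietoris_shortExact : (mayerVietoris I J).ShortExact where
  exact := by
    rw [ShortComplex.moduleCat_exact_iff]
    rintro ⟨x, y⟩ h
    obtain ⟨x, rfl⟩ := Submodule.Quotient.mk_surjective _ x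
    obtain ⟨y, rfl⟩ := Submodule.Quotient.mk_surjective _ y
    have h' : (Submodule.Quotient.mk x - Submodule.Quotient.mk y : R ⧸ I ⊔ J) = 0 :=
      (sub_eq_add_neg _ _).trans h
    rw [← Submodule.Quotient.mk_sub, Submodule.Quotient.mk_eq_zero, Submodule.mem_sup] at h'
    obtain ⟨a, ha, b, hb, e⟩ := h'
    refine ⟨Submodule.Quotient.mk (x - a), Prod.ext ?_ ?_⟩
    · exact (Submodule.Quotient.eq _).2 (by simpa using ha)
    · refine (Submodule.Quotient.eq _).2 ?_
      change x - a - y ∈ J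
      rwa [sub_right_comm, ← e, add_sub_cancel_left]
  mono_f := by
    rw [ModuleCat.mono_iff_injective]
    refine (injective_iff_map_eq_zero (mayerVietoris I J).f.hom).2 fun x h => ?_
    obtain ⟨x, rfl⟩ := Submodule.Quotient.mk_surjective _ x
    exact (Submodule.Quotient.mk_eq_zero (I ⊓ J)).2
      ⟨(Submodule.Quotient.mk_eq_zero I).1 (congrArg Prod.fst h),
        (Submodule.Quotient.mk_eq_zero J).1 (congrArg Prod.snd h)⟩
  epi_g := by
    rw [ModuleCat.epi_iff_surjective]
    intro x
    obtain ⟨x, rfl⟩ := Submodule.Quotient.mk_surjective _ x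
    refine ⟨(Submodule.Quotient.mk x, 0), ?_⟩
    exact (congrArg (_ + ·) (map_zero (-Submodule.factor le_sup_right))).trans (add_zero _)

lemma prod_shortExact (M N : ModuleCat.{0} R) :
    (ShortComplex.mk (ModuleCat.ofHom (LinearMap.inl R M N)) (ModuleCat.ofHom (LinearMap.snd R M N))
      (ModuleCat.hom_ext (LinearMap.ext fun _ => rfl))).ShortExact where
  exact := by
    rw [ShortComplex.moduleCat_exact_iff]
    rintro ⟨x, y⟩ h
    exact ⟨x, Prod.ext rfl (Eq.symm h)⟩
  mono_f := (ModuleCat.mono_iff_injective _).2 LinearMap.inl_injective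
  epi_g := (ModuleCat.epi_iff_surjective _).2 LinearMap.snd_surjective

end quotients

end

section stanleyReisner
variable {k : Type} [Field k] {n : ℕ} {Δ Γ : Set (Finset (Fin n))}

lemma srIdeal_inter : srIdeal k (Δ ∩ Γ) = srIdeal k Δ ⊔ srIdeal k Γ := by
  rw [srIdeal, srIdeal, srIdeal, ← Ideal.span_union]
  congr 1
  ext m
  simp only [Set.mem_ofPred_eq, Set.mem_inter_iff, Set.mem_union, not_and_or]
  constructor
  · rintro ⟨F, h | h, rfl⟩
    exacts [.inl ⟨F, h, rfl⟩, .inr ⟨F, h, rfl⟩]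
  · rintro (⟨F, h, rfl⟩ | ⟨F, h, rfl⟩)
    exacts [⟨F, .inl h, rfl⟩, ⟨F, .inr h, rfl⟩]

lemma mem_srIdeal_iff (hΔ : IsSimplicialComplex Δ) (p : MvPolynomial (Fin n) k) :
    p ∈ srIdeal k Δ ↔ ∀ m ∈ p.support, m.support ∉ Δ := by
  have h : srIdeal k Δ = Ideal.span ((fun s => monomial s (1 : k)) ''
      ((fun F : Finset (Fin n) => ∑ i ∈ F, Finsupp.single i 1) '' Δᶜ)) := by
    rw [srIdeal, Set.image_image]
    congr 1
    ext m
    simp only [Set.mem_ofPred_eq, Set.mem_image, Set.mem_compl_iff, monomial_sum_one, X, eq_comm]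
  have hs (F : Finset (Fin n)) (m : Fin n →₀ ℕ) :
      ∑ i ∈ F, Finsupp.single i 1 ≤ m ↔ F ⊆ m.support := by
    simp only [Finsupp.le_def, Finset.subset_iff, Finsupp.mem_support_iff,
      Finsupp.finsetSum_apply, Finsupp.single_apply, Finset.sum_ite_eq']
    refine forall_congr' fun i => ?_
    split_ifs with hi <;> simp [hi, Nat.one_le_iff_ne_zero]
  rw [h, mem_ideal_span_monomial_image]
  refine forall₂_congr fun m _ => ?_
  simp only [Set.mem_image, Set.mem_compl_iff, exists_exists_and_eq_and, hs]
  exact ⟨fun ⟨F, hF, hFm⟩ hm => hF (hΔ _ hm _ hFm), fun hm => ⟨_, hm, subset_rfl⟩⟩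

lemma srIdeal_union (hΔ : IsSimplicialComplex Δ) (hΓ : IsSimplicialComplex Γ) :
    srIdeal k (Δ ∪ Γ) = srIdeal k Δ ⊓ srIdeal k Γ := by
  have h : IsSimplicialComplex (Δ ∪ Γ) := fun F hF G hG =>
    hF.imp (fun h => hΔ F h G hG) (fun h => hΓ F h G hG)
  ext p
  simp only [Ideal.mem_inf, mem_srIdeal_iff h, mem_srIdeal_iff hΔ, mem_srIdeal_iff hΓ,
    Set.mem_union, not_or, forall_and]

lemma ringKrullDim_quotient_facePrime_le (F : Finset (Fin n)) :
    ringKrullDim (MvPolynomial (Fin n) k ⧸ facePrime k F) ≤ F.card := by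
  have hsurj : Function.Surjective (aeval (R := k) (fun i : F =>
      Ideal.Quotient.mk (facePrime k F) (X i.1))) := by
    rw [← AlgHom.range_eq_top, eq_top_iff, ← (Ideal.Quotient.mkₐ k (facePrime k F)).range_eq_top.2
      (Ideal.Quotient.mkₐ_surjective _ _), ← Algebra.map_top, ← adjoin_range_X, AlgHom.map_adjoin,
      Algebra.adjoin_le_iff]
    rintro _ ⟨_, ⟨i, rfl⟩, rfl⟩
    by_cases hi : i ∈ F
    · exact ⟨X ⟨i, hi⟩, by simp⟩
    · have hX : (X i : MvPolynomial (Fin n) k) ∈ facePrime k F :=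
        Ideal.subset_span (Set.mem_image_of_mem X (show i ∈ {j | j ∉ F} from hi))
      exact ⟨0, (map_zero _).trans (Ideal.Quotient.eq_zero_iff_mem.2 hX).symm⟩
  refine (ringKrullDim_le_of_surjective (aeval (R := k) fun i : F =>
    Ideal.Quotient.mk (facePrime k F) (X i.1)).toRingHom hsurj).trans ?_
  simp [MvPolynomial.ringKrullDim_of_isNoetherianRing]

lemma card_le_ringKrullDim_quotient_srIdeal {F : Finset (Fin n)} (hΔ : IsSimplicialComplex Δ)
    (hF : F ∈ Δ) :
    (F.card : WithBot ℕ∞) ≤ ringKrullDim (MvPolynomial (Fin n) k ⧸ srIdeal k Δ) := by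
  let φ : MvPolynomial (Fin n) k →ₐ[k] MvPolynomial F k :=
    aeval fun i => if h : i ∈ F then X ⟨i, h⟩ else 0
  have hφ : ∀ p ∈ srIdeal k Δ, φ p = 0 := by
    intro p hp
    refine (Ideal.span_le (I := RingHom.ker φ)).2 ?_ hp
    rintro _ ⟨G, hG, rfl⟩
    obtain ⟨i, hiG, hiF⟩ := Finset.not_subset.1 fun h => hG (hΔ F hF G h)
    change φ _ = 0
    rw [map_prod]
    exact Finset.prod_eq_zero hiG (by simp [φ, hiF])
  have hsurj : Function.Surjective φ := by
    rw [← AlgHom.range_eq_top, eq_top_iff, ← adjoin_range_X, Algebra.adjoin_le_iff]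
    rintro _ ⟨i, rfl⟩
    exact ⟨X i.1, by simp [φ]⟩
  have := ringKrullDim_le_of_surjective (Ideal.Quotient.lift (srIdeal k Δ) φ.toRingHom hφ)
    (Ideal.Quotient.lift_surjective_of_surjective _ _ hsurj)
  simpa [MvPolynomial.ringKrullDim_of_isNoetherianRing] using this

lemma ringKrullDim_quotient_srIdeal_le {d : ℕ} (h : ∀ F ∈ Δ, F.card ≤ d) :
    ringKrullDim (MvPolynomial (Fin n) k ⧸ srIdeal k Δ) ≤ d := by
  classical
  rw [ringKrullDim_quotient]
  refine iSup_le fun s => ?_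
  let P := s.head.1.asIdeal
  let G : Finset (Fin n) := {j | X j ∉ P}
  have hG : G ∈ Δ := by
    by_contra hG
    have : ∏ i ∈ G, X i ∈ P := s.head.2 (Ideal.subset_span ⟨G, hG, rfl⟩)
    obtain ⟨i, hi, hiP⟩ := (Ideal.IsPrime.prod_mem_iff (hp := s.head.1.2)).1 this
    exact (Finset.mem_filter.1 hi).2 hiP
  have hP : facePrime k G ≤ P := by
    refine Ideal.span_le.2 ?_
    rintro _ ⟨j, hj, rfl⟩
    simpa [G] using hj
  let t : LTSeries (PrimeSpectrum.zeroLocus (R := MvPolynomial (Fin n) k) (facePrime k G)) :=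
    { length := s.length
      toFun := fun i => ⟨(s i).1, fun x hx => (LTSeries.head_le s i : s.head.1 ≤ (s i).1) (hP hx)⟩
      step := fun i => s.step i }
  calc (s.length : WithBot ℕ∞) ≤ Order.krullDim _ := Order.LTSeries.length_le_krullDim t
    _ ≤ (G.card : WithBot ℕ∞) := by
      rw [← ringKrullDim_quotient]; exact ringKrullDim_quotient_facePrime_le (k := k) G
    _ ≤ d := by exact_mod_cast h G hG

lemma bddAbove_image_card (Δ : Set (Finset (Fin n))) :
    BddAbove ((fun F : Finset (Fin n) => (F.card : ℤ) - 1) '' Δ) :=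
  (Set.toFinite _).bddAbove

lemma ringKrullDim_quotient_srIdeal (hΔ : IsSimplicialComplex Δ) (hne : Δ.Nonempty) {d : ℕ}
    (hd : complexDim Δ = (d : ℤ) - 1) :
    ringKrullDim (MvPolynomial (Fin n) k ⧸ srIdeal k Δ) = d := by
  have hbdd := bddAbove_image_card Δ
  obtain ⟨F, hF, hFd⟩ := Int.csSup_mem (hne.image _) hbdd
  refine le_antisymm (ringKrullDim_quotient_srIdeal_le fun G hG => ?_) ?_
  · have : (G.card : ℤ) - 1 ≤ complexDim Δ := le_csSup hbdd ⟨G, hG, rfl⟩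
    omega
  · have : F.card = d := by
      simp only [complexDim] at hd
      simp only [hd] at hFd
      omega
    exact this ▸ card_le_ringKrullDim_quotient_srIdeal hΔ hF

lemma complexDim_union (hΔ : Δ.Nonempty) (hΓ : Γ.Nonempty) :
    complexDim (Δ ∪ Γ) = complexDim Δ ⊔ complexDim Γ := by
  rw [complexDim, Set.image_union, csSup_union (bddAbove_image_card Δ) (hΔ.image _)
    (bddAbove_image_card Γ) (hΓ.image _)]
  rfl

lemma neg_one_le_complexDim (h : ∅ ∈ Δ) : -1 ≤ complexDim Δ :=
  le_csSup (bddAbove_image_card Δ) ⟨∅, h, by simp⟩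

lemma quotCM_srIdeal_iff (hΔ : IsSimplicialComplex Δ) (hne : Δ.Nonempty) {d : ℕ}
    (hd : complexDim Δ = (d : ℤ) - 1) :
    quotCM k (Fin n) (srIdeal k Δ) ↔
      ∀ i < d, Subsingleton (locCoh k (Fin n) (srIdeal k Δ) i) := by
  rw [quotCM, ringKrullDim_quotient_srIdeal hΔ hne hd]
  exact forall_congr' fun i => imp_congr_left (Nat.cast_lt (α := WithBot ℕ∞))

end stanleyReisner

/-- **Lemma (Hibi).** If `Δ` and `Γ` are Cohen–Macaulay simplicial complexes of the same
dimension `d` on `[n]` and `dim (Δ ∩ Γ) = d - 1`, then `Δ ∪ Γ` is Cohen–Macaulay if and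
only if `Δ ∩ Γ` is Cohen–Macaulay. -/
theorem cm_union_iff_cm_inter_codim_one {n : ℕ} (Δ Γ : Set (Finset (Fin n)))
    (hΔ : IsSimplicialComplex Δ) (hΓ : IsSimplicialComplex Γ)
    (hΔne : Δ.Nonempty) (hΓne : Γ.Nonempty) (d : ℤ)
    (hdΔ : complexDim Δ = d) (hdΓ : complexDim Γ = d)
    (hcmΔ : complexCM Δ) (hcmΓ : complexCM Γ)
    (hdInter : complexDim (Δ ∩ Γ) = d - 1) :
    complexCM (Δ ∪ Γ) ↔ complexCM (Δ ∩ Γ) := by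
  have hempty : ∅ ∈ Δ ∩ Γ :=
    ⟨hΔ _ hΔne.some_mem _ (Finset.empty_subset _), hΓ _ hΓne.some_mem _ (Finset.empty_subset _)⟩
  have hd := neg_one_le_complexDim hempty
  obtain ⟨D, rfl⟩ : ∃ D : ℕ, d = (D : ℤ) := ⟨d.toNat, by omega⟩
  have hΔ' : complexDim Δ = ((D + 1 : ℕ) : ℤ) - 1 := by simpa using hdΔ
  have hΓ' : complexDim Γ = ((D + 1 : ℕ) : ℤ) - 1 := by simpa using hdΓ
  have hU : complexDim (Δ ∪ Γ) = ((D + 1 : ℕ) : ℤ) - 1 := by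
    rw [complexDim_union hΔne hΓne, hΔ', hΓ', sup_idem]
  refine forall₂_congr fun k _ => ?_
  have hcΔ := (quotCM_srIdeal_iff hΔ hΔne hΔ').1 (hcmΔ k)
  have hcΓ := (quotCM_srIdeal_iff hΓ hΓne hΓ').1 (hcmΓ k)
  rw [quotCM_srIdeal_iff (fun F hF G hG => hF.imp (hΔ F · G hG) (hΓ F · G hG))
    (hΔne.mono Set.subset_union_left) hU, quotCM_srIdeal_iff
    (fun F hF G hG => hF.imp (hΔ F · G hG) (hΓ F · G hG)) ⟨∅, hempty⟩ hdInter,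
    srIdeal_union hΔ hΓ, srIdeal_inter]
  have hmid (i : ℕ) (hi : i < D + 1) := subsingleton_localCohomology_X₂
    (prod_shortExact (.of _ (MvPolynomial (Fin n) k ⧸ srIdeal k Δ))
      (.of _ (MvPolynomial (Fin n) k ⧸ srIdeal k Γ))) (hcΔ i hi) (hcΓ i hi)
  have hS := mayerVietoris_shortExact (srIdeal k Δ) (srIdeal k Γ)
  constructor
  · exact fun h j hj => subsingleton_localCohomology_X₃ hS (hmid j (by omega))
      (h (j + 1) (by omega))
  · rintro h (_ | j) hj
    · exact subsingleton_localCohomology_zero_X₁ hS (hmid 0 hj)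
    · exact subsingleton_localCohomology_succ_X₁ hS (h j (by omega)) (hmid (j + 1) hj)
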